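/- Let S_III be the symmetric 3×3 real matrix with rows (0,0,0),(0,0,1),(0,1,0) (the Petrov type III normal form, with Ψ₃ = 1 and all other curvature components zero). Then the stabilizer algebra stab(S_III) = {A ∈ so(G) : Aᵀ·S_III + S_III·A = 0} is the zero subspace. -/

import Mathlib

open Matrix

/-- The Gram matrix of the 3-dimensional Lorentzian inner product in a null triad. -/
noncomputable def Gmat : Matrix (Fin 3) (Fin 3) ℝ := !![0, 0, -1; 0, 1/2, 0; -1, 0, 0]

/-- The stabilizer algebra of a symmetric matrix `S` inside `so(G)`:
matrices `A` with `Aᵀ·G + G·A = 0` and `Aᵀ·S + S·A = 0`. -/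
noncomputable def stab (S : Matrix (Fin 3) (Fin 3) ℝ) :
    Submodule ℝ (Matrix (Fin 3) (Fin 3) ℝ) where
  carrier := {A | Aᵀ * Gmat + Gmat * A = 0 ∧ Aᵀ * S + S * A = 0}
  zero_mem' := by constructor <;> simp
  add_mem' := by
    rintro a b ⟨ha1, ha2⟩ ⟨hb1, hb2⟩
    constructor
    · have h : (a + b)ᵀ * Gmat + Gmat * (a + b)
          = (aᵀ * Gmat + Gmat * a) + (bᵀ * Gmat + Gmat * b) := by
        rw [Matrix.transpose_add]; noncomm_ring
      rw [h, ha1, hb1, add_zero]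
    · have h : (a + b)ᵀ * S + S * (a + b)
          = (aᵀ * S + S * a) + (bᵀ * S + S * b) := by
        rw [Matrix.transpose_add]; noncomm_ring
      rw [h, ha2, hb2, add_zero]
  smul_mem' := by
    rintro c a ⟨ha1, ha2⟩
    constructor
    · have h : (c • a)ᵀ * Gmat + Gmat * (c • a) = c • (aᵀ * Gmat + Gmat * a) := by
        rw [Matrix.transpose_smul, Matrix.smul_mul, Matrix.mul_smul, smul_add]
      rw [h, ha1, smul_zero]
    · have h : (c • a)ᵀ * S + S * (c • a) = c • (aᵀ * S + S * a) := by
        rw [Matrix.transpose_smul, Matrix.smul_mul, Matrix.mul_smul, smul_add]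
      rw [h, ha2, smul_zero]

/-- The Petrov type III normal form (`Ψ₃ = 1`, all other components zero). -/
noncomputable def S_III : Matrix (Fin 3) (Fin 3) ℝ := !![0, 0, 0; 0, 0, 1; 0, 1, 0]

/-- The stabilizer algebra of the Petrov type III normal form is the zero subspace
(table entry `s₀ = 0` for type III). -/
theorem stab_typeIII : stab S_III = ⊥ := by
  rw [eq_bot_iff]
  rintro A ⟨hG, hS⟩
  rw [← Matrix.ext_iff] at hG hS
  simp [Fin.forall_fin_succ, Matrix.mul_apply, Matrix.vecMul, dotProduct, Fin.sum_univ_three,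
    Gmat, S_III] at hG hS
  rw [Submodule.mem_bot]
  ext i j
  fin_cases i <;> fin_cases j <;> simp <;> linarith
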